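/- Let W be a bi-regular multiplicative unitary on a complex Hilbert space H and define Δ(a) := W(a ⊗ 1)W* for a ∈ A(W). Then the Podleś conditions hold: [Δ(a)·(b ⊗ 1) : a, b ∈ A(W)] = A(W) ⊗min A(W) and [Δ(a)·(1 ⊗ b) : a, b ∈ A(W)] = A(W) ⊗min A(W). In particular Δ maps A(W) into the multipliers of A(W) ⊗min A(W), making (A(W), Δ) a bi-simplifiable C*-bialgebra. -/

import Mathlib

/-!
Common framework: we axiomatize realizations of Hilbert-space tensor products.
A `TensorPair E F EF` realizes the Hilbert tensor product `E ⊗ F` as the Hilbert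
space `EF`: it consists of a bilinear map `(a, b) ↦ a ⊗ b` whose image satisfies
the characteristic inner-product identity and has total (dense) linear span.
Operators such as the leg operators `X₁₂`, `X₂₃`, `X₁₃`, amplifications `a ⊗ b`,
and the tensor flip `Σ` are then uniquely characterized by their matrix
coefficients against elementary tensors.
-/

noncomputable section

open scoped InnerProductSpace
open ContinuousLinearMap

/-- A realization of the Hilbert tensor product `E ⊗ F` as the Hilbert space `EF`. -/
structure TensorPair (E F EF : Type*)
    [NormedAddCommGroup E] [InnerProductSpace ℂ E]
    [NormedAddCommGroup F] [InnerProductSpace ℂ F]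
    [NormedAddCommGroup EF] [InnerProductSpace ℂ EF] where
  tmul : E →ₗ[ℂ] F →ₗ[ℂ] EF
  inner_tmul : ∀ (a c : E) (b d : F), ⟪tmul a b, tmul c d⟫_ℂ = ⟪a, c⟫_ℂ * ⟪b, d⟫_ℂ
  dense_span : Dense (Submodule.span ℂ {z : EF | ∃ a b, z = tmul a b} : Set EF)

/-- A realization of the threefold Hilbert tensor product `E ⊗ F ⊗ G` as `EFG`. -/
structure TensorTriple (E F G EFG : Type*)
    [NormedAddCommGroup E] [InnerProductSpace ℂ E]
    [NormedAddCommGroup F] [InnerProductSpace ℂ F]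
    [NormedAddCommGroup G] [InnerProductSpace ℂ G]
    [NormedAddCommGroup EFG] [InnerProductSpace ℂ EFG] where
  tmul : E →ₗ[ℂ] F →ₗ[ℂ] G →ₗ[ℂ] EFG
  inner_tmul : ∀ (a a' : E) (b b' : F) (c c' : G),
    ⟪tmul a b c, tmul a' b' c'⟫_ℂ = ⟪a, a'⟫_ℂ * ⟪b, b'⟫_ℂ * ⟪c, c'⟫_ℂ
  dense_span : Dense (Submodule.span ℂ {z : EFG | ∃ a b c, z = tmul a b c} : Set EFG)

/-- The norm-closed linear span `[S]` of a set of vectors/operators. -/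
def cspan {V : Type*} [NormedAddCommGroup V] [NormedSpace ℂ V] (S : Set V) : Set V :=
  closure (Submodule.span ℂ S : Set V)

/-- The set of right-leg slices `(id ⊗ ω_{ξ,η})(X)` of an operator
`X : M₁ ⊗ K₁ → M₂ ⊗ K₂`, i.e. all operators `T : M₁ → M₂` such that
`⟪ζ, T ζ'⟫ = ⟪ζ ⊗ ξ, X (ζ' ⊗ η)⟫` for some `ξ ∈ K₂`, `η ∈ K₁`. -/
def slicesR {M₁ K₁ M₂ K₂ Ha Hb : Type*}
    [NormedAddCommGroup M₁] [InnerProductSpace ℂ M₁]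
    [NormedAddCommGroup K₁] [InnerProductSpace ℂ K₁]
    [NormedAddCommGroup M₂] [InnerProductSpace ℂ M₂]
    [NormedAddCommGroup K₂] [InnerProductSpace ℂ K₂]
    [NormedAddCommGroup Ha] [InnerProductSpace ℂ Ha]
    [NormedAddCommGroup Hb] [InnerProductSpace ℂ Hb]
    (ta : TensorPair M₁ K₁ Ha) (tb : TensorPair M₂ K₂ Hb)
    (X : Ha →L[ℂ] Hb) : Set (M₁ →L[ℂ] M₂) :=
  {T | ∃ (ξ : K₂) (η : K₁), ∀ (ζ : M₂) (ζ' : M₁),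
    ⟪ζ, T ζ'⟫_ℂ = ⟪tb.tmul ζ ξ, X (ta.tmul ζ' η)⟫_ℂ}

/-- The set of left-leg slices `(ω_{ξ,η} ⊗ id)(X)` of an operator
`X : K₁ ⊗ M₁ → K₂ ⊗ M₂`, i.e. all operators `T : M₁ → M₂` such that
`⟪ζ, T ζ'⟫ = ⟪ξ ⊗ ζ, X (η ⊗ ζ')⟫` for some `ξ ∈ K₂`, `η ∈ K₁`. -/
def slicesL {M₁ K₁ M₂ K₂ Ha Hb : Type*}
    [NormedAddCommGroup M₁] [InnerProductSpace ℂ M₁]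
    [NormedAddCommGroup K₁] [InnerProductSpace ℂ K₁]
    [NormedAddCommGroup M₂] [InnerProductSpace ℂ M₂]
    [NormedAddCommGroup K₂] [InnerProductSpace ℂ K₂]
    [NormedAddCommGroup Ha] [InnerProductSpace ℂ Ha]
    [NormedAddCommGroup Hb] [InnerProductSpace ℂ Hb]
    (ta : TensorPair K₁ M₁ Ha) (tb : TensorPair K₂ M₂ Hb)
    (X : Ha →L[ℂ] Hb) : Set (M₁ →L[ℂ] M₂) :=
  {T | ∃ (ξ : K₂) (η : K₁), ∀ (ζ : M₂) (ζ' : M₁),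
    ⟪ζ, T ζ'⟫_ℂ = ⟪tb.tmul ξ ζ, X (ta.tmul η ζ')⟫_ℂ}

/-- `Â(X) := [(id ⊗ ω_{ξ,η})(X) : ξ, η ∈ H] ⊆ B(H)` for `X ∈ B(H ⊗ H)`. -/
def hatA {H H2 : Type*}
    [NormedAddCommGroup H] [InnerProductSpace ℂ H]
    [NormedAddCommGroup H2] [InnerProductSpace ℂ H2]
    (t2 : TensorPair H H H2) (X : H2 →L[ℂ] H2) : Set (H →L[ℂ] H) :=
  cspan (slicesR t2 t2 X)

/-- `A(X) := [(ω_{ξ,η} ⊗ id)(X) : ξ, η ∈ H] ⊆ B(H)` for `X ∈ B(H ⊗ H)`. -/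
def legA {H H2 : Type*}
    [NormedAddCommGroup H] [InnerProductSpace ℂ H]
    [NormedAddCommGroup H2] [InnerProductSpace ℂ H2]
    (t2 : TensorPair H H H2) (X : H2 →L[ℂ] H2) : Set (H →L[ℂ] H) :=
  cspan (slicesL t2 t2 X)

/-- `T` is the tensor-product operator `a ⊗ b : E ⊗ F → E' ⊗ F'`, characterized by its
matrix coefficients against elementary tensors.  In particular `IsTensorOp ta tb a 1 T`
says that `T = a ⊗ 1`, and `IsTensorOp ta tb 1 b T` that `T = 1 ⊗ b`. -/
def IsTensorOp {E F EF E' F' EF' : Type*}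
    [NormedAddCommGroup E] [InnerProductSpace ℂ E]
    [NormedAddCommGroup F] [InnerProductSpace ℂ F]
    [NormedAddCommGroup EF] [InnerProductSpace ℂ EF]
    [NormedAddCommGroup E'] [InnerProductSpace ℂ E']
    [NormedAddCommGroup F'] [InnerProductSpace ℂ F']
    [NormedAddCommGroup EF'] [InnerProductSpace ℂ EF']
    (ta : TensorPair E F EF) (tb : TensorPair E' F' EF')
    (a : E →L[ℂ] E') (b : F →L[ℂ] F') (T : EF →L[ℂ] EF') : Prop :=
  ∀ (ζ : E') (ξ : F') (ζ' : E) (η : F),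
    ⟪tb.tmul ζ ξ, T (ta.tmul ζ' η)⟫_ℂ = ⟪ζ, a ζ'⟫_ℂ * ⟪ξ, b η⟫_ℂ

/-- `A ⊗min B := [(a ⊗ 1)(1 ⊗ b) : a ∈ A, b ∈ B] = [a ⊗ b : a ∈ A, b ∈ B]`. -/
def minTensor {E F EF : Type*}
    [NormedAddCommGroup E] [InnerProductSpace ℂ E]
    [NormedAddCommGroup F] [InnerProductSpace ℂ F]
    [NormedAddCommGroup EF] [InnerProductSpace ℂ EF]
    (t : TensorPair E F EF)
    (A : Set (E →L[ℂ] E)) (B : Set (F →L[ℂ] F)) : Set (EF →L[ℂ] EF) :=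
  cspan {T | ∃ a ∈ A, ∃ b ∈ B, IsTensorOp t t a b T}

/-- `Y = X₁₂ = X ⊗ 1` on `E ⊗ F ⊗ G`, for `X ∈ B(E ⊗ F)`. -/
def IsLeg12 {E F G EF EFG : Type*}
    [NormedAddCommGroup E] [InnerProductSpace ℂ E]
    [NormedAddCommGroup F] [InnerProductSpace ℂ F]
    [NormedAddCommGroup G] [InnerProductSpace ℂ G]
    [NormedAddCommGroup EF] [InnerProductSpace ℂ EF]
    [NormedAddCommGroup EFG] [InnerProductSpace ℂ EFG]
    (t2 : TensorPair E F EF) (t3 : TensorTriple E F G EFG)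
    (X : EF →L[ℂ] EF) (Y : EFG →L[ℂ] EFG) : Prop :=
  ∀ (a a' : E) (b b' : F) (c c' : G),
    ⟪t3.tmul a b c, Y (t3.tmul a' b' c')⟫_ℂ
      = ⟪t2.tmul a b, X (t2.tmul a' b')⟫_ℂ * ⟪c, c'⟫_ℂ

/-- `Y = X₂₃ = 1 ⊗ X` on `E ⊗ F ⊗ G`, for `X ∈ B(F ⊗ G)`. -/
def IsLeg23 {E F G FG EFG : Type*}
    [NormedAddCommGroup E] [InnerProductSpace ℂ E]
    [NormedAddCommGroup F] [InnerProductSpace ℂ F]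
    [NormedAddCommGroup G] [InnerProductSpace ℂ G]
    [NormedAddCommGroup FG] [InnerProductSpace ℂ FG]
    [NormedAddCommGroup EFG] [InnerProductSpace ℂ EFG]
    (t2 : TensorPair F G FG) (t3 : TensorTriple E F G EFG)
    (X : FG →L[ℂ] FG) (Y : EFG →L[ℂ] EFG) : Prop :=
  ∀ (a a' : E) (b b' : F) (c c' : G),
    ⟪t3.tmul a b c, Y (t3.tmul a' b' c')⟫_ℂ
      = ⟪t2.tmul b c, X (t2.tmul b' c')⟫_ℂ * ⟪a, a'⟫_ℂ

/-- `Y = X₁₃ = Σ₁₂X₂₃Σ₁₂` on `E ⊗ F ⊗ G`, for `X ∈ B(E ⊗ G)`: `X` acting on the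
first and third legs. -/
def IsLeg13 {E F G EG EFG : Type*}
    [NormedAddCommGroup E] [InnerProductSpace ℂ E]
    [NormedAddCommGroup F] [InnerProductSpace ℂ F]
    [NormedAddCommGroup G] [InnerProductSpace ℂ G]
    [NormedAddCommGroup EG] [InnerProductSpace ℂ EG]
    [NormedAddCommGroup EFG] [InnerProductSpace ℂ EFG]
    (t2 : TensorPair E G EG) (t3 : TensorTriple E F G EFG)
    (X : EG →L[ℂ] EG) (Y : EFG →L[ℂ] EFG) : Prop :=
  ∀ (a a' : E) (b b' : F) (c c' : G),
    ⟪t3.tmul a b c, Y (t3.tmul a' b' c')⟫_ℂ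
      = ⟪t2.tmul a c, X (t2.tmul a' c')⟫_ℂ * ⟪b, b'⟫_ℂ

/-! ### Infrastructure on tensor pairs -/

open scoped TensorProduct

namespace TensorPair

section infra

variable {E F EF E' F' EF' G X : Type*}
    [NormedAddCommGroup E] [InnerProductSpace ℂ E]
    [NormedAddCommGroup F] [InnerProductSpace ℂ F]
    [NormedAddCommGroup EF] [InnerProductSpace ℂ EF]
    [NormedAddCommGroup E'] [InnerProductSpace ℂ E']
    [NormedAddCommGroup F'] [InnerProductSpace ℂ F']
    [NormedAddCommGroup EF'] [InnerProductSpace ℂ EF']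
    [NormedAddCommGroup G] [InnerProductSpace ℂ G]
    [NormedAddCommGroup X] [InnerProductSpace ℂ X]

/-- The canonical map from the algebraic tensor product. -/
def J (t : TensorPair E F EF) : E ⊗[ℂ] F →ₗ[ℂ] EF := TensorProduct.lift t.tmul

lemma J_tmul (t : TensorPair E F EF) (a : E) (b : F) : t.J (a ⊗ₜ b) = t.tmul a b := by
  simp [J]

lemma inner_J (t : TensorPair E F EF) (z w : E ⊗[ℂ] F) : ⟪t.J z, t.J w⟫_ℂ = ⟪z, w⟫_ℂ := by
  induction z with
  | zero => simp
  | add x y hx hy => simp [inner_add_left, hx, hy]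
  | tmul a b =>
    induction w with
    | zero => simp
    | add x y hx hy => simp [inner_add_right, hx, hy]
    | tmul c d => simp [J_tmul, t.inner_tmul]

lemma norm_J (t : TensorPair E F EF) (z : E ⊗[ℂ] F) : ‖t.J z‖ = ‖z‖ := by
  rw [@norm_eq_sqrt_re_inner ℂ, @norm_eq_sqrt_re_inner ℂ, inner_J]

lemma denseRange_J (t : TensorPair E F EF) : DenseRange t.J := by
  refine t.dense_span.mono ?_
  have : Submodule.span ℂ {z : EF | ∃ a b, z = t.tmul a b} ≤ LinearMap.range t.J := by
    rw [Submodule.span_le]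
    rintro _ ⟨a, b, rfl⟩
    exact ⟨a ⊗ₜ b, t.J_tmul a b⟩
  exact this

lemma norm_tmul (t : TensorPair E F EF) (a : E) (b : F) : ‖t.tmul a b‖ = ‖a‖ * ‖b‖ := by
  rw [← J_tmul, norm_J, TensorProduct.norm_tmul]

/-- The continuous bilinear tensor map. -/
def ket (t : TensorPair E F EF) : E →L[ℂ] F →L[ℂ] EF :=
  t.tmul.mkContinuous₂ 1 fun a b => by rw [norm_tmul]; simp

@[simp] lemma ket_apply (t : TensorPair E F EF) (a : E) (b : F) : t.ket a b = t.tmul a b := rfl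

/-- The swapped tensor pair. -/
def swap (t : TensorPair E F EF) : TensorPair F E EF where
  tmul := t.tmul.flip
  inner_tmul a c b d := by simp [t.inner_tmul, mul_comm]
  dense_span := by
    convert t.dense_span using 5 with z
    exact exists_comm

@[simp] lemma swap_tmul (t : TensorPair E F EF) (a : E) (b : F) :
    t.swap.tmul b a = t.tmul a b := rfl

lemma ext_vec (t : TensorPair E F EF) {x y : EF}
    (h : ∀ a b, ⟪t.tmul a b, x⟫_ℂ = ⟪t.tmul a b, y⟫_ℂ) : x = y := by
  refine t.dense_span.eq_of_inner_right ℂ fun v hv => ?_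
  induction hv using Submodule.span_induction with
  | mem v hv => obtain ⟨a, b, rfl⟩ := hv; exact h a b
  | zero => simp
  | add u v _ _ hu hv => simp [inner_add_left, hu, hv]
  | smul c u _ hu => simp [inner_smul_left, hu]

lemma ext_clm (t : TensorPair E F EF) {S T : EF →L[ℂ] X}
    (h : ∀ a b, S (t.tmul a b) = T (t.tmul a b)) : S = T := by
  ext x
  refine t.denseRange_J.induction_on x
    (isClosed_eq S.continuous T.continuous) fun z => ?_
  induction z with
  | zero => simp
  | add x y hx hy => simp [hx, hy]
  | tmul a b => simpa [J_tmul] using h a b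

section amp
variable (t : TensorPair E F EF) (t' : TensorPair E F' EF')

lemma amp_bound (a : F →L[ℂ] F') (z : E ⊗[ℂ] F) :
    ‖(t'.J ∘ₗ (a.lTensor E).toLinearMap) z‖ ≤ ‖a‖ * ‖t.J z‖ := by
  rw [norm_J]
  simp only [LinearMap.comp_apply, norm_J]
  exact ((a.lTensor E).le_opNorm z).trans
    (mul_le_mul_of_nonneg_right (ContinuousLinearMap.norm_lTensor_le _ a) (norm_nonneg _))

variable [CompleteSpace EF']

/-- The underlying function of `amp`. -/
def ampFun (a : F →L[ℂ] F') : EF →L[ℂ] EF' :=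
  (t'.J ∘ₗ (a.lTensor E).toLinearMap).extendOfNorm t.J

lemma ampFun_tmul (a : F →L[ℂ] F') (x : E) (y : F) :
    ampFun t t' a (t.tmul x y) = t'.tmul x (a y) := by
  rw [← J_tmul, ampFun, LinearMap.extendOfNorm_eq t.denseRange_J ⟨‖a‖, amp_bound t t' a⟩]
  simp [J_tmul]

/-- The amplification `a ↦ 1 ⊗ a`. -/
def amp : (F →L[ℂ] F') →L[ℂ] (EF →L[ℂ] EF') :=
  LinearMap.mkContinuous
    { toFun := ampFun t t'
      map_add' := fun a b => t.ext_clm fun x y => by simp [ampFun_tmul]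
      map_smul' := fun c a => t.ext_clm fun x y => by simp [ampFun_tmul] } 1
    fun a => by
      rw [one_mul]
      exact LinearMap.opNorm_extendOfNorm_le t.denseRange_J (norm_nonneg _) (amp_bound t t' a)

@[simp] lemma amp_tmul (a : F →L[ℂ] F') (x : E) (y : F) :
    amp t t' a (t.tmul x y) = t'.tmul x (a y) := ampFun_tmul t t' a x y

lemma amp_ket (a : F →L[ℂ] F') (x : E) : amp t t' a ∘L t.ket x = t'.ket x ∘L a := by
  ext y; simp

lemma amp_adjoint [CompleteSpace F] [CompleteSpace F'] [CompleteSpace EF] (a : F →L[ℂ] F') :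
    adjoint (amp t t' a) = amp t' t (adjoint a) := by
  refine t'.ext_clm fun x y => t.ext_vec fun x' y' => ?_
  rw [adjoint_inner_right, amp_tmul, amp_tmul, t.inner_tmul, t'.inner_tmul, adjoint_inner_right]

lemma ket_adjoint_tmul [CompleteSpace F] [CompleteSpace EF] (ξ x : E) (y : F) :
    adjoint (t.ket ξ) (t.tmul x y) = ⟪ξ, x⟫_ℂ • y := by
  refine ext_inner_left ℂ fun v => ?_
  rw [adjoint_inner_right, ket_apply, t.inner_tmul, inner_smul_right]

lemma ket_adjoint_ket [CompleteSpace F] [CompleteSpace EF] (ξ η : E) :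
    adjoint (t.ket ξ) ∘L t.ket η = ⟪ξ, η⟫_ℂ • ContinuousLinearMap.id ℂ F := by
  ext y; simp [ket_adjoint_tmul]

lemma ket_adjoint_amp [CompleteSpace F] [CompleteSpace F'] [CompleteSpace EF]
    (a : F →L[ℂ] F') (x : E) :
    adjoint (t'.ket x) ∘L amp t t' a = a ∘L adjoint (t.ket x) := by
  refine t.ext_clm fun u v => ?_
  simp [ket_adjoint_tmul]

/-- `1 ⊗ a` and `b ⊗ 1` commute. -/
lemma amp_comm [CompleteSpace EF] (a : F →L[ℂ] F) (b : E →L[ℂ] E) :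
    amp t t a * amp t.swap t.swap b = amp t.swap t.swap b * amp t t a := by
  refine t.ext_clm fun u v => ?_
  have h : ∀ x y, amp t.swap t.swap b (t.tmul x y) = t.tmul (b x) y :=
    fun x y => amp_tmul t.swap t.swap b y x
  simp only [mul_apply_eq_comp, amp_tmul, h]

lemma amp_mul [CompleteSpace EF] (a b : F →L[ℂ] F) :
    amp t t (a * b) = amp t t a * amp t t b := by
  refine t.ext_clm fun u v => ?_
  simp

lemma amp_one [CompleteSpace EF] : amp t t (1 : F →L[ℂ] F) = 1 := by
  refine t.ext_clm fun u v => ?_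
  simp

end amp

section assoc

variable [CompleteSpace X]
/-- Auxiliary associator: from a trilinear map. -/
def assocFun (t : TensorPair E F EF) (m : G →ₗ[ℂ] E →ₗ[ℂ] F →ₗ[ℂ] X) (g : G) : EF →L[ℂ] X :=
  (TensorProduct.lift (m g)).extendOfNorm t.J

variable (t : TensorPair E F EF) (m : G →ₗ[ℂ] E →ₗ[ℂ] F →ₗ[ℂ] X)

lemma lift_inner
    (hm : ∀ g g' e e' f f', ⟪m g e f, m g' e' f'⟫_ℂ = ⟪g, g'⟫_ℂ * (⟪e, e'⟫_ℂ * ⟪f, f'⟫_ℂ))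
    (g g' : G) (z w : E ⊗[ℂ] F) :
    ⟪TensorProduct.lift (m g) z, TensorProduct.lift (m g') w⟫_ℂ = ⟪g, g'⟫_ℂ * ⟪z, w⟫_ℂ := by
  induction z with
  | zero => simp
  | add x y hx hy => simp [inner_add_left, hx, hy, mul_add]
  | tmul a b =>
    induction w with
    | zero => simp
    | add x y hx hy => rw [map_add, inner_add_right, hx, hy, inner_add_right, mul_add]
    | tmul c d => simp [hm]

lemma assocFun_J
    (hm : ∀ g g' e e' f f', ⟪m g e f, m g' e' f'⟫_ℂ = ⟪g, g'⟫_ℂ * (⟪e, e'⟫_ℂ * ⟪f, f'⟫_ℂ))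
    (g : G) (z : E ⊗[ℂ] F) :
    assocFun t m g (t.J z) = TensorProduct.lift (m g) z := by
  refine LinearMap.extendOfNorm_eq t.denseRange_J ⟨‖g‖, fun z => ?_⟩ z
  refine le_of_sq_le_sq ?_ (by positivity)
  rw [mul_pow]
  have h := lift_inner m hm g g z z
  rw [← t.inner_J, inner_self_eq_norm_sq_to_K, inner_self_eq_norm_sq_to_K, inner_self_eq_norm_sq_to_K] at h
  exact le_of_eq (by exact_mod_cast h)

lemma assocFun_tmul
    (hm : ∀ g g' e e' f f', ⟪m g e f, m g' e' f'⟫_ℂ = ⟪g, g'⟫_ℂ * (⟪e, e'⟫_ℂ * ⟪f, f'⟫_ℂ))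
    (g : G) (e : E) (f : F) :
    assocFun t m g (t.tmul e f) = m g e f := by
  rw [← J_tmul, assocFun_J t m hm]; simp


/-- Tensor pair `G ⊗ (E ⊗ F)` from a trilinear map. -/
def assoc
    (hm : ∀ g g' e e' f f', ⟪m g e f, m g' e' f'⟫_ℂ = ⟪g, g'⟫_ℂ * (⟪e, e'⟫_ℂ * ⟪f, f'⟫_ℂ))
    (hd : Dense (Submodule.span ℂ {z : X | ∃ g e f, z = m g e f} : Set X)) :
    TensorPair G EF X where
  tmul :=
    { toFun := fun g => (assocFun t m g).toLinearMap
      map_add' := fun g g' => by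
        rw [← ContinuousLinearMap.toLinearMap_add]
        congr 1
        exact t.ext_clm fun x y => by simp [assocFun_tmul t m hm]
      map_smul' := fun c g => by
        rw [RingHom.id_apply, ← ContinuousLinearMap.toLinearMap_smul]
        congr 1
        exact t.ext_clm fun x y => by simp [assocFun_tmul t m hm] }
  inner_tmul a c b d := by
    refine t.denseRange_J.induction_on₂ (p := fun b d =>
      ⟪assocFun t m a b, assocFun t m c d⟫_ℂ = ⟪a, c⟫_ℂ * ⟪b, d⟫_ℂ) ?_ (fun z w => ?_) b d
    · exact isClosed_eq (by fun_prop) (by fun_prop)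
    · rw [assocFun_J t m hm, assocFun_J t m hm, lift_inner m hm, inner_J]
  dense_span := by
    refine hd.mono (Submodule.span_mono ?_)
    rintro _ ⟨g, e, f, rfl⟩
    exact ⟨g, t.tmul e f, (assocFun_tmul t m hm g e f).symm⟩

lemma assoc_tmul
    (hm : ∀ g g' e e' f f', ⟪m g e f, m g' e' f'⟫_ℂ = ⟪g, g'⟫_ℂ * (⟪e, e'⟫_ℂ * ⟪f, f'⟫_ℂ))
    (hd : Dense (Submodule.span ℂ {z : X | ∃ g e f, z = m g e f} : Set X))
    (g : G) (e : E) (f : F) : (assoc t m hm hd).tmul g (t.tmul e f) = m g e f :=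
  assocFun_tmul t m hm g e f

end assoc

end infra

end TensorPair
/-! ### Closed spans -/

/-- Continuous additive maps that send lines to lines. -/
structure Nice {V V' : Type*} [NormedAddCommGroup V] [NormedSpace ℂ V]
    [NormedAddCommGroup V'] [NormedSpace ℂ V'] (f : V → V') : Prop where
  cont : Continuous f
  add : ∀ x y, f (x + y) = f x + f y
  smul : ∀ (c : ℂ) x, ∃ d : ℂ, f (c • x) = d • f x

section closedspan
variable {V V' : Type*} [NormedAddCommGroup V] [NormedSpace ℂ V]
    [NormedAddCommGroup V'] [NormedSpace ℂ V']

lemma Nice.mem_cspan {f : V → V'} (hf : Nice f) {M : Submodule ℂ V'} (hM : IsClosed (M : Set V'))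
    {S : Set V} (h : ∀ x ∈ S, f x ∈ M) {x : V} (hx : x ∈ cspan S) : f x ∈ M := by
  have h0 : f 0 = 0 := by
    have := hf.add 0 0
    simpa using this
  have hcl : IsClosed {x | f x ∈ M} := hM.preimage hf.cont
  refine closure_minimal (t := {x | f x ∈ M}) ?_ hcl hx
  intro y hy
  induction hy using Submodule.span_induction with
  | mem v hv => exact h v hv
  | zero => simp only [Set.mem_setOf_eq, h0, M.zero_mem]
  | add u v _ _ hu hv => rw [Set.mem_setOf_eq, hf.add]; exact M.add_mem hu hv
  | smul c u _ hu =>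
    obtain ⟨d, hd⟩ := hf.smul c u
    rw [Set.mem_setOf_eq, hd]; exact M.smul_mem d hu

lemma nice_id : Nice (fun x : V => x) := ⟨continuous_id, fun _ _ => rfl, fun c _ => ⟨c, rfl⟩⟩

lemma subset_cspan (S : Set V) : S ⊆ cspan S :=
  Submodule.subset_span.trans subset_closure

/-- The closed span as a submodule. -/
def cspanM (S : Set V) : Submodule ℂ V := (Submodule.span ℂ S).topologicalClosure

lemma mem_cspanM {S : Set V} {x : V} : x ∈ cspanM S ↔ x ∈ cspan S := Iff.rfl

lemma isClosed_cspanM (S : Set V) : IsClosed (cspanM S : Set V) :=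
  Submodule.isClosed_topologicalClosure _

lemma cspan_subset {S : Set V} {M : Submodule ℂ V} (hM : IsClosed (M : Set V))
    (h : ∀ x ∈ S, x ∈ M) : ∀ x ∈ cspan S, x ∈ M :=
  fun _ hx => nice_id.mem_cspan hM h hx

lemma cspan_eq {S S' : Set V} (h : ∀ x ∈ S, x ∈ cspan S') (h' : ∀ x ∈ S', x ∈ cspan S) :
    cspan S = cspan S' :=
  Set.Subset.antisymm (cspan_subset (isClosed_cspanM S') h) (cspan_subset (isClosed_cspanM S) h')

end closedspan

section compact
variable {H : Type*} [NormedAddCommGroup H] [InnerProductSpace ℂ H] [CompleteSpace H]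

lemma rankOne_compact (p q : H) : IsCompactOperator (InnerProductSpace.rankOne ℂ p q : H →L[ℂ] H) := by
  rw [InnerProductSpace.rankOne_def']
  exact (isCompactOperator_of_locallyCompactSpace_rng
    (ContinuousLinearMap.toSpanSingleton ℂ p)).comp_clm (innerSL ℂ q)

lemma compact_mem {T : H →L[ℂ] H} (hT : IsCompactOperator T) :
    T ∈ cspan {S : H →L[ℂ] H | ∃ p q, S = InnerProductSpace.rankOne ℂ p q} := by
  rw [cspan, Metric.mem_closure_iff]
  intro ε hε
  have htb : TotallyBounded (T '' Metric.closedBall 0 1) :=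
    (hT.isCompact_closure_image_closedBall 1).totallyBounded.subset subset_closure
  obtain ⟨s, hs, hsub⟩ := Metric.totallyBounded_iff.1 htb (ε / 2) (by positivity)
  let U := Submodule.span ℂ s
  haveI : FiniteDimensional ℂ U := FiniteDimensional.span_of_finite ℂ hs
  refine ⟨U.starProjection ∘L T, ?_, ?_⟩
  · let b := stdOrthonormalBasis ℂ U
    have : U.starProjection ∘L T
        = ∑ i, (InnerProductSpace.rankOne ℂ (b i : H) (adjoint T (b i : H)) : H →L[ℂ] H) := by
      ext x
      simp only [ContinuousLinearMap.comp_apply, ContinuousLinearMap.sum_apply,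
        InnerProductSpace.rankOne_apply, adjoint_inner_left]
      rw [Submodule.starProjection_apply, b.orthogonalProjection_apply_eq_sum]
      simp
    rw [this]
    exact Submodule.sum_mem _ fun i _ => Submodule.subset_span ⟨_, _, rfl⟩
  · rw [dist_eq_norm]
    refine lt_of_le_of_lt (ContinuousLinearMap.opNorm_le_of_unit_norm (C := ε/2) (by positivity) ?_) (by linarith)
    intro x hx
    have : T x ∈ ⋃ y ∈ s, Metric.ball y (ε/2) := hsub ⟨x, by simp [hx], rfl⟩
    simp only [Set.mem_iUnion, Metric.mem_ball] at this
    obtain ⟨y, hy, hxy⟩ := this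
    have h1 := U.starProjection_minimal (T x)
    have hb : BddBelow (Set.range fun w : U => ‖T x - w‖) := ⟨0, by rintro _ ⟨w, rfl⟩; positivity⟩
    have h2 := ciInf_le hb ⟨y, Submodule.subset_span hy⟩
    simp only [ContinuousLinearMap.sub_apply, ContinuousLinearMap.comp_apply]
    rw [h1]
    refine h2.trans ?_
    rw [← dist_eq_norm]
    exact hxy.le

end compact
/-! ### The set-up -/

namespace TensorPair
variable {E F EF : Type*}
    [NormedAddCommGroup E] [InnerProductSpace ℂ E]
    [NormedAddCommGroup F] [InnerProductSpace ℂ F] [CompleteSpace F]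
    [NormedAddCommGroup EF] [InnerProductSpace ℂ EF] [CompleteSpace EF]

/-- The adjoint of `ket`. -/
def bra (t : TensorPair E F EF) (ξ : E) : EF →L[ℂ] F := adjoint (t.ket ξ)

@[simp] lemma bra_tmul (t : TensorPair E F EF) (ξ x : E) (y : F) :
    t.bra ξ (t.tmul x y) = ⟪ξ, x⟫_ℂ • y := t.ket_adjoint_tmul ξ x y

lemma inner_bra (t : TensorPair E F EF) (ξ : E) (y : F) (z : EF) :
    ⟪y, t.bra ξ z⟫_ℂ = ⟪t.tmul ξ y, z⟫_ℂ := by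
  rw [bra, adjoint_inner_right, ket_apply]

lemma bra_amp (t : TensorPair E F EF) {F' EF' : Type*}
    [NormedAddCommGroup F'] [InnerProductSpace ℂ F'] [CompleteSpace F']
    [NormedAddCommGroup EF'] [InnerProductSpace ℂ EF'] [CompleteSpace EF']
    (t' : TensorPair E F' EF') (a : F →L[ℂ] F') (ξ : E) (z : EF) :
    t'.bra ξ (amp t t' a z) = a (t.bra ξ z) :=
  DFunLike.congr_fun (ket_adjoint_amp t t' a ξ) z

lemma bra_add (t : TensorPair E F EF) (ξ η : E) : t.bra (ξ + η) = t.bra ξ + t.bra η := by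
  simp [bra]

lemma bra_smul (t : TensorPair E F EF) (c : ℂ) (ξ : E) :
    t.bra (c • ξ) = (starRingEnd ℂ c) • t.bra ξ := by
  rw [bra, map_smul, map_smulₛₗ]; rfl

@[fun_prop] lemma continuous_bra (t : TensorPair E F EF) : Continuous t.bra :=
  (adjoint (𝕜 := ℂ) (E := F) (F := EF)).continuous.comp t.ket.continuous

end TensorPair

open TensorPair

/-- The data of a multiplicative unitary, in a convenient form. -/
structure MU (H H2 H3 : Type*)
    [NormedAddCommGroup H] [InnerProductSpace ℂ H] [CompleteSpace H]
    [NormedAddCommGroup H2] [InnerProductSpace ℂ H2] [CompleteSpace H2]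
    [NormedAddCommGroup H3] [InnerProductSpace ℂ H3] [CompleteSpace H3] where
  t : TensorPair H H H2
  q1 : TensorPair H H2 H3
  q2 : TensorPair H H2 H3
  q3 : TensorPair H H2 H3
  h12 : ∀ a b c, q1.tmul a (t.tmul b c) = q2.tmul b (t.tmul a c)
  h32 : ∀ a b c, q3.tmul c (t.tmul a b) = q2.tmul b (t.tmul a c)
  W : H2 →L[ℂ] H2
  V : H2 →L[ℂ] H2
  hV : adjoint W = V
  hWV : W * V = 1
  hVW : V * W = 1
  pent : amp q1 q1 W * amp q3 q3 W = amp q3 q3 W * amp q2 q2 W * amp q1 q1 W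
  reg : cspan {T : H →L[ℂ] H | ∃ ξ η, T = t.bra ξ ∘L W ∘L t.swap.ket η}
    = cspan {T : H →L[ℂ] H | ∃ p q, T = InnerProductSpace.rankOne ℂ p q}

namespace MU
variable {H H2 H3 : Type*}
    [NormedAddCommGroup H] [InnerProductSpace ℂ H] [CompleteSpace H]
    [NormedAddCommGroup H2] [InnerProductSpace ℂ H2] [CompleteSpace H2]
    [NormedAddCommGroup H3] [InnerProductSpace ℂ H3] [CompleteSpace H3]
variable (D : MU H H2 H3)

/-- `W₁₂`. -/
def W12 : H3 →L[ℂ] H3 := amp D.q3 D.q3 D.W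
/-- `W₁₃`. -/
def W13 : H3 →L[ℂ] H3 := amp D.q2 D.q2 D.W
/-- `W₂₃`. -/
def W23 : H3 →L[ℂ] H3 := amp D.q1 D.q1 D.W
/-- `W₁₂*`. -/
def V12 : H3 →L[ℂ] H3 := amp D.q3 D.q3 D.V
/-- `W₁₃*`. -/
def V13 : H3 →L[ℂ] H3 := amp D.q2 D.q2 D.V
/-- `W₂₃*`. -/
def V23 : H3 →L[ℂ] H3 := amp D.q1 D.q1 D.V

@[simp] lemma WV (x) : D.W (D.V x) = x := DFunLike.congr_fun D.hWV x
@[simp] lemma VW (x) : D.V (D.W x) = x := DFunLike.congr_fun D.hVW x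

@[simp] lemma WV12 (x) : D.W12 (D.V12 x) = x := by
  have := amp_mul D.q3 D.W D.V
  rw [D.hWV, amp_one] at this
  exact (DFunLike.congr_fun this x).symm
@[simp] lemma VW12 (x) : D.V12 (D.W12 x) = x := by
  have := amp_mul D.q3 D.V D.W
  rw [D.hVW, amp_one] at this
  exact (DFunLike.congr_fun this x).symm
@[simp] lemma WV23 (x) : D.W23 (D.V23 x) = x := by
  have := amp_mul D.q1 D.W D.V
  rw [D.hWV, amp_one] at this
  exact (DFunLike.congr_fun this x).symm
@[simp] lemma VW23 (x) : D.V23 (D.W23 x) = x := by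
  have := amp_mul D.q1 D.V D.W
  rw [D.hVW, amp_one] at this
  exact (DFunLike.congr_fun this x).symm

lemma pent_apply (x) : D.W23 (D.W12 x) = D.W12 (D.W13 (D.W23 x)) := DFunLike.congr_fun D.pent x

lemma pentA (x) : D.W13 (D.W23 x) = D.V12 (D.W23 (D.W12 x)) := by
  rw [pent_apply, VW12]

lemma pentB (x) : D.W12 (D.W13 x) = D.W23 (D.W12 (D.V23 x)) := by
  rw [pent_apply, WV23]

lemma pentC (x) : D.V23 (D.W12 (D.W13 x)) = D.W12 (D.V23 x) := by
  rw [pentB, VW23]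

/-! Exchange relations -/

lemma k12 (a : H) (b : H) (c : H) : D.q1.tmul a (D.t.tmul b c) = D.q2.tmul b (D.t.tmul a c) :=
  D.h12 a b c

lemma k32 (a : H) (b : H) (c : H) : D.q3.tmul c (D.t.tmul a b) = D.q2.tmul b (D.t.tmul a c) :=
  D.h32 a b c

lemma ind (p : H2 → Prop) (hc : IsClosed {x | p x}) (hadd : ∀ x y, p x → p y → p (x + y))
    (h0 : p 0) (h : ∀ a b, p (D.t.tmul a b)) (u : H2) : p u := by
  refine D.t.denseRange_J.induction_on u hc fun z => ?_
  induction z with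
  | zero => simpa using h0
  | add x y hx hy => simpa using hadd _ _ hx hy
  | tmul a b => simpa [J_tmul] using h a b

lemma B13 (ξ c : H) (u : H2) :
    D.q1.bra ξ (D.q3.tmul c u) = D.t.tmul (D.t.bra ξ u) c := by
  have : D.q1.bra ξ ∘L D.q3.ket c = D.t.swap.ket c ∘L D.t.bra ξ :=
    D.t.ext_clm fun a b => by simp [k32, ← k12]
  exact DFunLike.congr_fun this u

lemma B23 (ξ c : H) (u : H2) :
    D.q2.bra ξ (D.q3.tmul c u) = D.t.tmul (D.t.swap.bra ξ u) c := by
  have : D.q2.bra ξ ∘L D.q3.ket c = D.t.swap.ket c ∘L D.t.swap.bra ξ :=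
    D.t.ext_clm fun a b => by
      have := D.t.swap.bra_tmul ξ b a
      rw [swap_tmul] at this
      simp [k32, this]
  exact DFunLike.congr_fun this u

lemma B21 (ξ a : H) (u : H2) :
    D.q2.bra ξ (D.q1.tmul a u) = D.t.tmul a (D.t.bra ξ u) := by
  have : D.q2.bra ξ ∘L D.q1.ket a = D.t.ket a ∘L D.t.bra ξ :=
    D.t.ext_clm fun a b => by simp [k12]
  exact DFunLike.congr_fun this u

lemma B12 (ξ a : H) (u : H2) :
    D.q1.bra ξ (D.q2.tmul a u) = D.t.tmul a (D.t.bra ξ u) := by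
  have : D.q1.bra ξ ∘L D.q2.ket a = D.t.ket a ∘L D.t.bra ξ :=
    D.t.ext_clm fun a b => by simp [← k12]
  exact DFunLike.congr_fun this u

/-- `a ⊗ 1`. -/
def L : (H →L[ℂ] H) →L[ℂ] (H2 →L[ℂ] H2) := amp D.t.swap D.t.swap
/-- `1 ⊗ a`. -/
def R : (H →L[ℂ] H) →L[ℂ] (H2 →L[ℂ] H2) := amp D.t D.t

@[simp] lemma L_tmul (a : H →L[ℂ] H) (x y : H) : D.L a (D.t.tmul x y) = D.t.tmul (a x) y :=
  amp_tmul D.t.swap D.t.swap a y x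
@[simp] lemma R_tmul (a : H →L[ℂ] H) (x y : H) : D.R a (D.t.tmul x y) = D.t.tmul x (a y) :=
  amp_tmul D.t D.t a x y

/-- The slices of `W`. -/
def s (ξ η : H) : H →L[ℂ] H := D.t.bra ξ ∘L D.W ∘L D.t.ket η
/-- The slices of `ΣW`. -/
def T (ξ η : H) : H →L[ℂ] H := D.t.bra ξ ∘L D.W ∘L D.t.swap.ket η

@[simp] lemma s_apply (ξ η x : H) : D.s ξ η x = D.t.bra ξ (D.W (D.t.tmul η x)) := rfl
@[simp] lemma T_apply (ξ η x : H) : D.T ξ η x = D.t.bra ξ (D.W (D.t.tmul x η)) := rfl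

lemma W12_q3 (c : H) (u : H2) : D.W12 (D.q3.tmul c u) = D.q3.tmul c (D.W u) := amp_tmul _ _ _ _ _
lemma V12_q3 (c : H) (u : H2) : D.V12 (D.q3.tmul c u) = D.q3.tmul c (D.V u) := amp_tmul _ _ _ _ _
lemma W23_q1 (c : H) (u : H2) : D.W23 (D.q1.tmul c u) = D.q1.tmul c (D.W u) := amp_tmul _ _ _ _ _
lemma V23_q1 (c : H) (u : H2) : D.V23 (D.q1.tmul c u) = D.q1.tmul c (D.V u) := amp_tmul _ _ _ _ _
lemma W13_q2 (c : H) (u : H2) : D.W13 (D.q2.tmul c u) = D.q2.tmul c (D.W u) := amp_tmul _ _ _ _ _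
lemma bra_W13 (c : H) (z : H3) : D.q2.bra c (D.W13 z) = D.W (D.q2.bra c z) := bra_amp _ _ _ _ _
lemma bra_W23 (c : H) (z : H3) : D.q1.bra c (D.W23 z) = D.W (D.q1.bra c z) := bra_amp _ _ _ _ _
lemma bra_V23 (c : H) (z : H3) : D.q1.bra c (D.V23 z) = D.V (D.q1.bra c z) := bra_amp _ _ _ _ _

lemma adj_V : adjoint D.V = D.W := by rw [← D.hV, adjoint_adjoint]

lemma adj_V12 : adjoint D.V12 = D.W12 := by rw [V12, amp_adjoint, adj_V]; rfl
lemma adj_W12 : adjoint D.W12 = D.V12 := by rw [W12, amp_adjoint, D.hV]; rfl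

/-- `F1`. -/
lemma F1 (ξ η : H) (z : H2) : D.q1.bra ξ (D.W12 (D.q2.tmul η z)) = D.L (D.T ξ η) z := by
  have : D.q1.bra ξ ∘L D.W12 ∘L D.q2.ket η = D.L (D.T ξ η) :=
    D.t.ext_clm fun a c => by simp [← k32, W12_q3, B13]
  exact DFunLike.congr_fun this z

lemma F1' (ξ η : H) (z : H2) :
    D.q2.bra η (D.V12 (D.q1.tmul ξ z)) = D.L (adjoint (D.T ξ η)) z := by
  have h : D.q1.bra ξ ∘L D.W12 ∘L D.q2.ket η = D.L (D.T ξ η) := by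
    ext z; exact D.F1 ξ η z
  have h2 := congrArg adjoint h
  rw [adjoint_comp, adjoint_comp, adj_W12, bra, adjoint_adjoint, L, amp_adjoint] at h2
  exact DFunLike.congr_fun h2 z

lemma F5 (ξ η : H) (z : H2) : D.q2.bra ξ (D.W23 (D.q2.tmul η z)) = D.R (D.s ξ η) z := by
  have : D.q2.bra ξ ∘L D.W23 ∘L D.q2.ket η = D.R (D.s ξ η) :=
    D.t.ext_clm fun a c => by simp [← k12, W23_q1, B21]
  exact DFunLike.congr_fun this z

lemma F5' (ξ η : H) (z : H2) : D.q1.bra ξ (D.W13 (D.q1.tmul η z)) = D.R (D.s ξ η) z := by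
  have : D.q1.bra ξ ∘L D.W13 ∘L D.q1.ket η = D.R (D.s ξ η) :=
    D.t.ext_clm fun a c => by simp [k12, W13_q2, B12]
  exact DFunLike.congr_fun this z

lemma F6 (ξ η : H) (z : H2) : D.q1.bra ξ (D.W12 (D.q1.tmul η z)) = D.L (D.s ξ η) z := by
  have : D.q1.bra ξ ∘L D.W12 ∘L D.q1.ket η = D.L (D.s ξ η) :=
    D.t.ext_clm fun a c => by simp [k12, ← k32, W12_q3, B13]
  exact DFunLike.congr_fun this z

lemma L_rankOne (p q : H) (z : H2) :
    D.L (InnerProductSpace.rankOne ℂ p q) z = D.t.tmul p (D.t.bra q z) := by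
  have : D.L (InnerProductSpace.rankOne ℂ p q) = D.t.ket p ∘L D.t.bra q :=
    D.t.ext_clm fun a c => by simp
  exact DFunLike.congr_fun this z

/-- `K(u)*`. -/
def Kb (u : H2) : H3 →L[ℂ] H := D.q3.swap.bra u
/-- `K(u)`. -/
def K (u : H2) : H →L[ℂ] H3 := D.q3.swap.ket u

@[simp] lemma K_apply (u : H2) (x : H) : D.K u x = D.q3.tmul x u := rfl

lemma Kb_tmul (a b : H) (z : H3) :
    D.Kb (D.t.tmul a b) z = D.t.bra b (D.q1.bra a z) := by
  refine ext_inner_left ℂ fun v => ?_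
  rw [Kb, inner_bra, inner_bra, inner_bra, swap_tmul, k32, k12]

lemma Kb_tmul' (a b : H) (z : H3) :
    D.Kb (D.t.tmul a b) z = D.t.bra a (D.q2.bra b z) := by
  refine ext_inner_left ℂ fun v => ?_
  rw [Kb, inner_bra, inner_bra, inner_bra, swap_tmul, k32]

lemma Kb_V12 (u : H2) (z : H3) : D.Kb u (D.V12 z) = D.Kb (D.W u) z := by
  refine ext_inner_left ℂ fun v => ?_
  rw [Kb, Kb, inner_bra, inner_bra, swap_tmul, swap_tmul, ← W12_q3, ← adj_V12, adjoint_inner_left]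

lemma Kb_W12 (u : H2) (z : H3) : D.Kb u (D.W12 z) = D.Kb (D.V u) z := by
  rw [← D.WV u, ← Kb_V12, VW12, WV]

/-! ### Induction principles -/

/-- a nice map of `u : H2` is determined, up to closed spans, by elementary tensors,
or by their images under `W`. -/
lemma mem_tmul {Y : Type*} [NormedAddCommGroup Y] [NormedSpace ℂ Y] {f : H2 → Y} (hf : Nice f)
    {M : Submodule ℂ Y} (hM : IsClosed (M : Set Y)) (h : ∀ a b, f (D.t.tmul a b) ∈ M) (u : H2) :
    f u ∈ M := by
  refine hf.mem_cspan hM (S := {z : H2 | ∃ a b, z = D.t.tmul a b}) ?_ (D.t.dense_span u)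
  rintro _ ⟨a, b, rfl⟩; exact h a b

lemma mem_Wtmul {Y : Type*} [NormedAddCommGroup Y] [NormedSpace ℂ Y] {f : H2 → Y} (hf : Nice f)
    {M : Submodule ℂ Y} (hM : IsClosed (M : Set Y)) (h : ∀ a b, f (D.W (D.t.tmul a b)) ∈ M)
    (u : H2) : f u ∈ M := by
  have hf' : Nice (fun u => f (D.W u)) :=
    ⟨hf.cont.comp D.W.continuous, fun x y => by rw [map_add, hf.add],
      fun c x => by simpa using hf.smul c (D.W x)⟩
  simpa using D.mem_tmul hf' hM h (D.V u)

lemma mem_Vtmul {Y : Type*} [NormedAddCommGroup Y] [NormedSpace ℂ Y] {f : H2 → Y} (hf : Nice f)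
    {M : Submodule ℂ Y} (hM : IsClosed (M : Set Y)) (h : ∀ a b, f (D.V (D.t.tmul a b)) ∈ M)
    (u : H2) : f u ∈ M := by
  have hf' : Nice (fun u => f (D.V u)) :=
    ⟨hf.cont.comp D.V.continuous, fun x y => by rw [map_add, hf.add],
      fun c x => by simpa using hf.smul c (D.V x)⟩
  simpa using D.mem_tmul hf' hM h (D.W u)

lemma mem_rank {Y : Type*} [NormedAddCommGroup Y] [NormedSpace ℂ Y] {f : (H →L[ℂ] H) → Y}
    (hf : Nice f) {M : Submodule ℂ Y} (hM : IsClosed (M : Set Y))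
    (h : ∀ ξ η, f (D.T ξ η) ∈ M) (p q : H) : f (InnerProductSpace.rankOne ℂ p q) ∈ M := by
  refine hf.mem_cspan hM (S := {T : H →L[ℂ] H | ∃ ξ η, T = D.T ξ η}) ?_ ?_
  · rintro _ ⟨a, b, rfl⟩; exact h a b
  · have := D.reg
    unfold T
    rw [this]
    exact subset_cspan _ ⟨p, q, rfl⟩

lemma mem_T {Y : Type*} [NormedAddCommGroup Y] [NormedSpace ℂ Y] {f : (H →L[ℂ] H) → Y}
    (hf : Nice f) {M : Submodule ℂ Y} (hM : IsClosed (M : Set Y))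
    (h : ∀ p q, f (InnerProductSpace.rankOne ℂ p q) ∈ M) (ξ η : H) : f (D.T ξ η) ∈ M := by
  refine hf.mem_cspan hM (S := {T : H →L[ℂ] H | ∃ p q, T = InnerProductSpace.rankOne ℂ p q}) ?_ ?_
  · rintro _ ⟨a, b, rfl⟩; exact h a b
  · rw [← D.reg]
    exact subset_cspan _ ⟨ξ, η, rfl⟩

end MU
section nice
variable {V V' V'' : Type*} [NormedAddCommGroup V] [NormedSpace ℂ V]
    [NormedAddCommGroup V'] [NormedSpace ℂ V'] [NormedAddCommGroup V''] [NormedSpace ℂ V'']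

lemma Nice.comp {g : V' → V''} {f : V → V'} (hg : Nice g) (hf : Nice f) :
    Nice (fun x => g (f x)) :=
  ⟨hg.cont.comp hf.cont, fun x y => by rw [hf.add, hg.add], fun c x => by
    obtain ⟨d, hd⟩ := hf.smul c x
    rw [hd]; exact hg.smul d (f x)⟩

lemma nice_clm (f : V →L[ℂ] V') : Nice f :=
  ⟨f.continuous, map_add f, fun c x => ⟨c, map_smul f c x⟩⟩

lemma nice_post (A : V' →L[ℂ] V'') : Nice (fun X : V →L[ℂ] V' => A ∘L X) :=
  nice_clm (ContinuousLinearMap.compL ℂ V V' V'' A)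

lemma nice_pre (A : V →L[ℂ] V') : Nice (fun X : V' →L[ℂ] V'' => X ∘L A) :=
  nice_clm ((ContinuousLinearMap.compL ℂ V V' V'').flip A)

end nice

section nice2
variable {E F EF : Type*}
    [NormedAddCommGroup E] [InnerProductSpace ℂ E]
    [NormedAddCommGroup F] [InnerProductSpace ℂ F] [CompleteSpace F]
    [NormedAddCommGroup EF] [InnerProductSpace ℂ EF] [CompleteSpace EF]

lemma nice_bra (t : TensorPair E F EF) : Nice t.bra :=
  ⟨t.continuous_bra, t.bra_add, fun c x => ⟨_, t.bra_smul c x⟩⟩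

lemma nice_ket (t : TensorPair E F EF) : Nice (fun x => t.ket x) := nice_clm t.ket

lemma nice_adjoint : Nice (fun X : F →L[ℂ] EF => adjoint X) :=
  ⟨(adjoint (𝕜 := ℂ) (E := F) (F := EF)).continuous, fun x y => map_add _ x y,
    fun c x => ⟨_, map_smulₛₗ _ c x⟩⟩

end nice2

namespace MU
variable {H H2 H3 : Type*}
    [NormedAddCommGroup H] [InnerProductSpace ℂ H] [CompleteSpace H]
    [NormedAddCommGroup H2] [InnerProductSpace ℂ H2] [CompleteSpace H2]
    [NormedAddCommGroup H3] [InnerProductSpace ℂ H3] [CompleteSpace H3]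
variable (D : MU H H2 H3)

lemma nice_Kb : Nice D.Kb := nice_bra D.q3.swap
lemma nice_K : Nice D.K := nice_ket D.q3.swap

/-- `A(W)` as a closed submodule. -/
def A : Submodule ℂ (H →L[ℂ] H) := cspanM {a | ∃ ξ η, a = D.s ξ η}

lemma isClosed_A : IsClosed (D.A : Set (H →L[ℂ] H)) := isClosed_cspanM _

lemma s_mem (ξ η : H) : D.s ξ η ∈ D.A := subset_cspan _ ⟨ξ, η, rfl⟩

lemma A_ind {Y : Type*} [NormedAddCommGroup Y] [NormedSpace ℂ Y] {f : (H →L[ℂ] H) → Y}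
    (hf : Nice f) {M : Submodule ℂ Y} (hM : IsClosed (M : Set Y))
    (h : ∀ ξ η, f (D.s ξ η) ∈ M) {a : H →L[ℂ] H} (ha : a ∈ D.A) : f a ∈ M := by
  refine hf.mem_cspan hM ?_ ha
  rintro _ ⟨ξ, η, rfl⟩; exact h ξ η

/-! ### multiplicativity -/

lemma G_mem (u v : H2) : D.Kb u ∘L D.W23 ∘L D.K v ∈ D.A := by
  refine D.mem_tmul (f := fun u => D.Kb u ∘L D.W23 ∘L D.K v)
    ((nice_pre (D.W23 ∘L D.K v)).comp D.nice_Kb) D.isClosed_A (fun a b => ?_) u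
  refine D.mem_tmul (f := fun v => D.Kb (D.t.tmul a b) ∘L D.W23 ∘L D.K v)
    (((nice_post _).comp (nice_post _)).comp D.nice_K) D.isClosed_A (fun c d => ?_) v
  have : D.Kb (D.t.tmul a b) ∘L D.W23 ∘L D.K (D.t.tmul c d) = ⟪a, c⟫_ℂ • D.s b d := by
    ext x
    simp [Kb_tmul, k32, ← k12, W23_q1]
  rw [this]
  exact D.A.smul_mem _ (D.s_mem _ _)

lemma s_mul_s (ξ η ξ' η' : H) : D.s ξ η ∘L D.s ξ' η'
    = D.Kb (D.W (D.t.tmul ξ ξ')) ∘L D.W23 ∘L D.K (D.W (D.t.tmul η η')) := by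
  ext x
  simp only [ContinuousLinearMap.comp_apply, K_apply, s_apply]
  rw [← Kb_V12, ← W12_q3, ← pentA, Kb_tmul', bra_W13, k32, ← k12, W23_q1, B21]

lemma mul_mem {a b : H →L[ℂ] H} (ha : a ∈ D.A) (hb : b ∈ D.A) : a * b ∈ D.A := by
  refine D.A_ind (f := fun a => a ∘L b) (nice_pre b) D.isClosed_A (fun ξ η => ?_) ha
  refine D.A_ind (f := fun b => D.s ξ η ∘L b) (nice_post _) D.isClosed_A (fun ξ' η' => ?_) hb
  rw [s_mul_s]
  exact D.G_mem _ _

/-! ### star -/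

/-- Slices of `W*`. -/
def sv (ξ η : H) : H →L[ℂ] H := D.t.bra ξ ∘L D.V ∘L D.t.ket η

lemma sv_apply (ξ η x : H) : D.sv ξ η x = D.t.bra ξ (D.V (D.t.tmul η x)) := rfl

lemma adj_s (ξ η : H) : adjoint (D.s ξ η) = D.sv η ξ := by
  rw [s, sv, adjoint_comp, adjoint_comp, D.hV, bra, adjoint_adjoint, bra]; rfl

lemma adj_sv (ξ η : H) : adjoint (D.sv ξ η) = D.s η ξ := by
  rw [← adj_s, adjoint_adjoint]

lemma fv_tmul (a b c d : H) :
    D.Kb (D.t.tmul a b) ∘L D.V23 ∘L D.K (D.t.tmul c d) = ⟪a, c⟫_ℂ • D.sv b d := by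
  ext x
  simp [Kb_tmul, k32, ← k12, V23_q1, sv_apply]

lemma gv_tmul (ξ ξ' η η' : H) :
    D.Kb (D.V (D.t.tmul ξ ξ')) ∘L D.V23 ∘L D.K (D.t.tmul η η')
      = D.t.bra ξ' ∘L D.V ∘L D.L (D.T ξ η') ∘L D.W ∘L D.t.ket η := by
  ext x
  simp only [ContinuousLinearMap.comp_apply, K_apply, ket_apply]
  rw [← Kb_W12, ← pentC, Kb_tmul, bra_V23, k32, W13_q2, F1]

lemma hv_rank (ξ' p q η : H) :
    D.t.bra ξ' ∘L D.V ∘L D.L (InnerProductSpace.rankOne ℂ p q) ∘L D.W ∘L D.t.ket η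
      = D.sv ξ' p ∘L D.s q η := by
  ext x
  simp only [ContinuousLinearMap.comp_apply, ket_apply, L_rankOne, sv_apply, s_apply]

lemma nice_fv1 (v : H2) : Nice (fun u => D.Kb u ∘L D.V23 ∘L D.K v) :=
  (nice_pre (D.V23 ∘L D.K v)).comp D.nice_Kb

lemma nice_fv2 (u : H2) : Nice (fun v => D.Kb u ∘L D.V23 ∘L D.K v) :=
  ((nice_post _).comp (nice_post _)).comp D.nice_K

lemma nice_hv (ξ' η : H) :
    Nice (fun X => D.t.bra ξ' ∘L D.V ∘L D.L X ∘L D.W ∘L D.t.ket η) :=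
  ((nice_post _).comp ((nice_post _).comp (nice_pre _))).comp (nice_clm D.L)

lemma star1 {N : Submodule ℂ (H →L[ℂ] H)} (hN : IsClosed (N : Set (H →L[ℂ] H)))
    (h : ∀ ξ η, D.sv ξ η ∈ N) (ξ p q η : H) : D.sv ξ p ∘L D.s q η ∈ N := by
  have hf : ∀ u v, D.Kb u ∘L D.V23 ∘L D.K v ∈ N := fun u v => by
    refine D.mem_tmul (D.nice_fv1 v) hN (fun a b => ?_) u
    refine D.mem_tmul (D.nice_fv2 _) hN (fun c d => ?_) v
    rw [fv_tmul]
    exact N.smul_mem _ (h _ _)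
  rw [← hv_rank]
  refine D.mem_rank (D.nice_hv ξ η) hN (fun a b => ?_) p q
  rw [← gv_tmul]
  exact hf _ _

lemma star2 {N : Submodule ℂ (H →L[ℂ] H)} (hN : IsClosed (N : Set (H →L[ℂ] H)))
    (h : ∀ ξ p q η, D.sv ξ p ∘L D.s q η ∈ N) (ξ η : H) : D.sv ξ η ∈ N := by
  have hf : ∀ u v, D.Kb u ∘L D.V23 ∘L D.K v ∈ N := fun u v => by
    refine D.mem_tmul (D.nice_fv2 _) hN (fun c d => ?_) v
    refine D.mem_Vtmul (D.nice_fv1 _) hN (fun a b => ?_) u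
    rw [gv_tmul]
    refine D.mem_T (D.nice_hv _ _) hN (fun p q => ?_) _ _
    rw [hv_rank]
    exact h _ _ _ _
  by_cases hξ : ξ = 0
  · have : D.sv ξ η = 0 := by
      rw [hξ, sv, bra]; simp
    rw [this]; exact N.zero_mem
  · have h1 := hf (D.t.tmul ξ ξ) (D.t.tmul ξ η)
    rw [fv_tmul] at h1
    exact (N.smul_mem_iff (inner_self_ne_zero.2 hξ)).1 h1

lemma sv_mem (ξ η : H) : D.sv ξ η ∈ D.A := by
  refine D.star2 D.isClosed_A (fun ξ p q η => ?_) ξ η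
  have h1 := D.star1 (N := cspanM {a | ∃ ξ η, a = D.sv ξ η}) (isClosed_cspanM _)
    (fun a b => subset_cspan _ ⟨a, b, rfl⟩) η q p ξ
  have h2 := nice_adjoint.mem_cspan D.isClosed_A (S := {a | ∃ ξ η, a = D.sv ξ η}) ?_ h1
  · rwa [adjoint_comp, adj_s, adj_sv] at h2
  · rintro _ ⟨a, b, rfl⟩
    rw [adj_sv]; exact D.s_mem _ _

lemma adj_mem {a : H →L[ℂ] H} (ha : a ∈ D.A) : adjoint a ∈ D.A := by
  refine D.A_ind nice_adjoint D.isClosed_A (fun ξ η => ?_) ha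
  rw [adj_s]; exact D.sv_mem _ _

/-! ### Claim 2 -/

lemma c2_W (ξ p η : H) : D.q2.bra ξ ∘L D.V12 ∘L D.W23 ∘L D.K (D.W (D.t.tmul p η))
    = D.W ∘L D.t.ket p ∘L D.s ξ η := by
  ext x
  simp only [ContinuousLinearMap.comp_apply, K_apply, ket_apply, s_apply]
  rw [← W12_q3, ← pentA, bra_W13, k32, ← k12, W23_q1, B21]

lemma c2_1 (ξ p η : H) : D.q2.bra ξ ∘L D.V12 ∘L D.W23 ∘L D.K (D.t.tmul p η)
    = D.L (adjoint (D.T p ξ)) ∘L D.W ∘L D.t.ket η := by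
  ext x
  simp only [ContinuousLinearMap.comp_apply, K_apply, ket_apply]
  rw [k32, ← k12, W23_q1, F1']

lemma c2_rank (a b η : H) :
    D.L (adjoint (InnerProductSpace.rankOne ℂ a b)) ∘L D.W ∘L D.t.ket η
      = D.t.ket b ∘L D.s a η := by
  ext x
  simp only [ContinuousLinearMap.comp_apply, ket_apply, s_apply,
    InnerProductSpace.adjoint_rankOne, L_rankOne]

lemma nice_c2 (ξ : H) : Nice (fun u => D.q2.bra ξ ∘L D.V12 ∘L D.W23 ∘L D.K u) :=
  ((nice_post _).comp ((nice_post _).comp (nice_post _))).comp D.nice_K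

lemma nice_c2' (η : H) :
    Nice (fun X : H →L[ℂ] H => D.L (adjoint X) ∘L D.W ∘L D.t.ket η) :=
  ((nice_pre _).comp (nice_clm D.L)).comp nice_adjoint

lemma claim2 {M : Submodule ℂ (H →L[ℂ] H2)} (hM : IsClosed (M : Set (H →L[ℂ] H2))) :
    (∀ p ξ η, D.W ∘L D.t.ket p ∘L D.s ξ η ∈ M) ↔ (∀ p ξ η, D.t.ket p ∘L D.s ξ η ∈ M) := by
  constructor
  · intro h p ξ η
    rw [← c2_rank]
    refine D.mem_rank (D.nice_c2' η) hM (fun a b => ?_) ξ p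
    rw [← c2_1]
    refine D.mem_Wtmul (D.nice_c2 _) hM (fun c d => ?_) _
    rw [c2_W]; exact h _ _ _
  · intro h p ξ η
    rw [← c2_W]
    refine D.mem_tmul (D.nice_c2 _) hM (fun c d => ?_) _
    rw [c2_1]
    refine D.mem_T (D.nice_c2' _) hM (fun a b => ?_) _ _
    rw [c2_rank]; exact h _ _ _

/-! ### Claim 3 -/

lemma c3_W (ξ p η : H) : D.Kb (D.W (D.t.tmul p ξ)) ∘L D.W23 ∘L D.W12 ∘L D.q2.ket η
    = D.t.bra p ∘L D.W ∘L D.R (D.s ξ η) := by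
  ext x
  simp only [ContinuousLinearMap.comp_apply, ket_apply]
  rw [← Kb_V12, ← pentA, Kb_tmul', bra_W13, F5]

lemma c3_1 (ξ p η : H) : D.Kb (D.t.tmul p ξ) ∘L D.W23 ∘L D.W12 ∘L D.q2.ket η
    = D.t.bra ξ ∘L D.W ∘L D.L (D.T p η) := by
  ext x
  simp only [ContinuousLinearMap.comp_apply, ket_apply]
  rw [Kb_tmul, bra_W23, F1]

lemma c3_rank (a b ξ : H) :
    D.t.bra ξ ∘L D.W ∘L D.L (InnerProductSpace.rankOne ℂ a b) = D.s ξ a ∘L D.t.bra b := by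
  ext x
  simp only [ContinuousLinearMap.comp_apply, s_apply, L_rankOne]

lemma nice_c3 (η : H) : Nice (fun u => D.Kb u ∘L D.W23 ∘L D.W12 ∘L D.q2.ket η) :=
  (nice_pre (D.W23 ∘L D.W12 ∘L D.q2.ket η)).comp D.nice_Kb

lemma nice_c3' (ξ : H) :
    Nice (fun X : H →L[ℂ] H => D.t.bra ξ ∘L D.W ∘L D.L X) :=
  ((nice_post _).comp (nice_post _)).comp (nice_clm D.L)

lemma claim3 {M : Submodule ℂ (H2 →L[ℂ] H)} (hM : IsClosed (M : Set (H2 →L[ℂ] H))) :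
    (∀ p ξ η, D.t.bra p ∘L D.W ∘L D.R (D.s ξ η) ∈ M)
      ↔ (∀ p ξ η, D.s ξ η ∘L D.t.bra p ∈ M) := by
  constructor
  · intro h p ξ η
    rw [← c3_rank]
    refine D.mem_rank (D.nice_c3' ξ) hM (fun a b => ?_) η p
    rw [← c3_1]
    refine D.mem_Wtmul (D.nice_c3 _) hM (fun c d => ?_) _
    rw [c3_W]; exact h _ _ _
  · intro h p ξ η
    rw [← c3_W]
    refine D.mem_tmul (D.nice_c3 _) hM (fun c d => ?_) _
    rw [c3_1]
    refine D.mem_T (D.nice_c3' _) hM (fun a b => ?_) _ _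
    rw [c3_rank]; exact h _ _ _

/-! ### The comultiplication -/

/-- `Δ(a) = W (a ⊗ 1) W*`. -/
def Δ (a : H →L[ℂ] H) : H2 →L[ℂ] H2 := D.W ∘L D.L a ∘L D.V

lemma nice_Δ : Nice D.Δ := ((nice_post _).comp (nice_pre _)).comp (nice_clm D.L)

lemma Δ_s (ξ η : H) (z : H2) :
    D.Δ (D.s ξ η) z = D.q1.bra ξ (D.W12 (D.W13 (D.q1.tmul η z))) := by
  rw [pentB, bra_W23, V23_q1, F6]; rfl

/-- The map used for the second Podleś condition. -/
def f2 (ξ : H) : (H →L[ℂ] H2) →L[ℂ] (H2 →L[ℂ] H2) :=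
  (ContinuousLinearMap.compL ℂ H2 H3 H2 (D.q1.bra ξ ∘L D.W12)) ∘L amp D.t D.q2

lemma f2_apply (ξ : H) (Z : H →L[ℂ] H2) (x y : H) :
    D.f2 ξ Z (D.t.tmul x y) = D.q1.bra ξ (D.W12 (D.q2.tmul x (Z y))) := by
  simp [f2]

lemma f2_W (ξ η : H) (b : H →L[ℂ] H) :
    D.f2 ξ (D.W ∘L D.t.ket η ∘L b) = D.Δ (D.s ξ η) * D.R b := by
  refine D.t.ext_clm fun x y => ?_
  rw [f2_apply, mul_apply_eq_comp, Δ_s, R_tmul, k12, W13_q2]; rfl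

lemma f2_1 (ξ η : H) (b : H →L[ℂ] H) :
    D.f2 ξ (D.t.ket η ∘L b) = D.L (D.s ξ η) * D.R b := by
  refine D.t.ext_clm fun x y => ?_
  rw [f2_apply, mul_apply_eq_comp, ← F6, R_tmul, k12]; rfl

lemma podles2 {M : Submodule ℂ (H2 →L[ℂ] H2)} (hM : IsClosed (M : Set (H2 →L[ℂ] H2))) :
    (∀ p q ξ η, D.Δ (D.s p q) * D.R (D.s ξ η) ∈ M)
      ↔ (∀ p q ξ η, D.L (D.s p q) * D.R (D.s ξ η) ∈ M) := by
  refine forall_congr' fun p => ?_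
  have hc : IsClosed ((M.comap (D.f2 p).toLinearMap : Submodule ℂ _) : Set (H →L[ℂ] H2)) :=
    hM.preimage (D.f2 p).continuous
  have := D.claim2 hc
  simpa only [Submodule.mem_comap, ContinuousLinearMap.coe_coe, f2_W, f2_1] using this

/-- The map used for the first Podleś condition. -/
def f1 (η : H) : (H2 →L[ℂ] H) →L[ℂ] (H2 →L[ℂ] H2) :=
  ((ContinuousLinearMap.compL ℂ H2 H3 H2).flip (D.W13 ∘L D.q1.ket η)) ∘L amp D.q3 D.t.swap

lemma f1_apply (η : H) (Y : H2 →L[ℂ] H) (z : H2) :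
    D.f1 η Y z = amp D.q3 D.t.swap Y (D.W13 (D.q1.tmul η z)) := rfl

lemma Ψ_bra (p : H) (Z : H2 →L[ℂ] H2) (z : H3) :
    amp D.q3 D.t.swap (D.t.bra p ∘L Z) z = D.q1.bra p (amp D.q3 D.q3 Z z) := by
  have : amp D.q3 D.t.swap (D.t.bra p ∘L Z) = D.q1.bra p ∘L amp D.q3 D.q3 Z :=
    D.q3.ext_clm fun c u => by simp [B13]
  exact DFunLike.congr_fun this z

lemma Ψ_s (p : H) (a : H →L[ℂ] H) (z : H3) :
    amp D.q3 D.t.swap (a ∘L D.t.bra p) z = D.L a (D.q1.bra p z) := by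
  have : amp D.q3 D.t.swap (a ∘L D.t.bra p) = D.L a ∘L D.q1.bra p :=
    D.q3.ext_clm fun c u => by simp [B13]
  exact DFunLike.congr_fun this z

/-- `b` acting on the second leg. -/
def leg2 (b : H →L[ℂ] H) : H3 →L[ℂ] H3 := amp D.q2.swap D.q2.swap b

lemma leg2_q2 (b : H →L[ℂ] H) (x : H) (u : H2) : D.leg2 b (D.q2.tmul x u) = D.q2.tmul (b x) u :=
  amp_tmul D.q2.swap D.q2.swap b u x

lemma leg2_comm (b : H →L[ℂ] H) (z : H3) : D.leg2 b (D.W13 z) = D.W13 (D.leg2 b z) :=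
  (DFunLike.congr_fun (amp_comm D.q2 D.W b) z).symm

lemma leg2_q3 (b : H →L[ℂ] H) (z : H3) : amp D.q3 D.q3 (D.R b) z = D.leg2 b z := by
  have : amp D.q3 D.q3 (D.R b) = D.leg2 b := by
    refine D.q3.ext_clm fun c u => ?_
    have : D.q3.ket c ∘L D.R b = D.leg2 b ∘L D.q3.ket c :=
      D.t.ext_clm fun x y => by simp [k32, leg2_q2]
    simpa using DFunLike.congr_fun this u
  rw [this]

lemma leg2_q1 (b : H →L[ℂ] H) (η : H) (z : H2) :
    D.leg2 b (D.q1.tmul η z) = D.q1.tmul η (D.L b z) := by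
  have : D.leg2 b ∘L D.q1.ket η = D.q1.ket η ∘L D.L b :=
    D.t.ext_clm fun x y => by simp [k12, leg2_q2]
  exact DFunLike.congr_fun this z

lemma f1_W (p η : H) (b : H →L[ℂ] H) :
    D.f1 η (D.t.bra p ∘L D.W ∘L D.R b) = D.Δ (D.s p η) * D.L b := by
  ext z
  rw [f1_apply, mul_apply_eq_comp, Δ_s, Ψ_bra, ← leg2_q1, ← leg2_comm, ← leg2_q3]
  have : amp D.q3 D.q3 (D.W ∘L D.R b) = amp D.q3 D.q3 D.W * amp D.q3 D.q3 (D.R b) :=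
    amp_mul D.q3 D.W (D.R b)
  rw [this]; rfl

lemma f1_1 (p η : H) (a : H →L[ℂ] H) :
    D.f1 η (a ∘L D.t.bra p) = D.L a * D.R (D.s p η) := by
  ext z
  rw [f1_apply, mul_apply_eq_comp, Ψ_s, F5']

lemma podles1 {M : Submodule ℂ (H2 →L[ℂ] H2)} (hM : IsClosed (M : Set (H2 →L[ℂ] H2))) :
    (∀ p q ξ η, D.Δ (D.s p q) * D.L (D.s ξ η) ∈ M)
      ↔ (∀ p q ξ η, D.L (D.s p q) * D.R (D.s ξ η) ∈ M) := by
  have key : ∀ q, (∀ p ξ η, D.Δ (D.s p q) * D.L (D.s ξ η) ∈ M)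
      ↔ (∀ p ξ η, D.L (D.s ξ η) * D.R (D.s p q) ∈ M) := fun q => by
    have hc : IsClosed ((M.comap (D.f1 q).toLinearMap : Submodule ℂ _) : Set (H2 →L[ℂ] H)) :=
      hM.preimage (D.f1 q).continuous
    have := D.claim3 hc
    simpa only [Submodule.mem_comap, ContinuousLinearMap.coe_coe, f1_W, f1_1] using this
  constructor
  · intro h p q ξ η
    exact (key η).1 (fun p ξ η' => h _ _ _ _) ξ p q
  · intro h p q ξ η
    exact (key q).2 (fun p ξ η => h _ _ _ _) p ξ η

/-! ### Passing to the algebra -/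

lemma two {f g : (H →L[ℂ] H) → (H2 →L[ℂ] H2)} (hf : Nice f) (hg : Nice g)
    {M : Submodule ℂ (H2 →L[ℂ] H2)} (hM : IsClosed (M : Set (H2 →L[ℂ] H2)))
    (h : ∀ p q ξ η, f (D.s p q) * g (D.s ξ η) ∈ M) {a b : H →L[ℂ] H} (ha : a ∈ D.A)
    (hb : b ∈ D.A) : f a * g b ∈ M := by
  refine D.A_ind (f := fun a => f a ∘L g b) ((nice_pre (g b)).comp hf) hM (fun p q => ?_) ha
  exact D.A_ind (f := fun b => f (D.s p q) ∘L g b) ((nice_post _).comp hg) hM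
    (fun ξ η => h p q ξ η) hb

/-- The minimal tensor product. -/
def MT : Submodule ℂ (H2 →L[ℂ] H2) :=
  cspanM {T | ∃ a ∈ D.A, ∃ b ∈ D.A, T = D.L a * D.R b}

lemma isClosed_MT : IsClosed (D.MT : Set (H2 →L[ℂ] H2)) := isClosed_cspanM _

lemma MT_mem {a b : H →L[ℂ] H} (ha : a ∈ D.A) (hb : b ∈ D.A) : D.L a * D.R b ∈ D.MT :=
  subset_cspan _ ⟨a, ha, b, hb, rfl⟩

lemma ΔL_mem {a b : H →L[ℂ] H} (ha : a ∈ D.A) (hb : b ∈ D.A) : D.Δ a * D.L b ∈ D.MT :=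
  D.two D.nice_Δ (nice_clm D.L) D.isClosed_MT ((D.podles1 D.isClosed_MT).2
    fun _ _ _ _ => D.MT_mem (D.s_mem _ _) (D.s_mem _ _)) ha hb

lemma ΔR_mem {a b : H →L[ℂ] H} (ha : a ∈ D.A) (hb : b ∈ D.A) : D.Δ a * D.R b ∈ D.MT :=
  D.two D.nice_Δ (nice_clm D.R) D.isClosed_MT ((D.podles2 D.isClosed_MT).2
    fun _ _ _ _ => D.MT_mem (D.s_mem _ _) (D.s_mem _ _)) ha hb

lemma LR_mem1 {a b : H →L[ℂ] H} (ha : a ∈ D.A) (hb : b ∈ D.A) :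
    D.L a * D.R b ∈ cspan {T | ∃ a ∈ D.A, ∃ b ∈ D.A, T = D.Δ a * D.L b} :=
  D.two (nice_clm D.L) (nice_clm D.R) (M := cspanM {T | ∃ a ∈ D.A, ∃ b ∈ D.A, T = D.Δ a * D.L b})
    (isClosed_cspanM _) ((D.podles1 (isClosed_cspanM _)).1
    fun _ _ _ _ => subset_cspan _ ⟨_, D.s_mem _ _, _, D.s_mem _ _, rfl⟩) ha hb

lemma LR_mem2 {a b : H →L[ℂ] H} (ha : a ∈ D.A) (hb : b ∈ D.A) :
    D.L a * D.R b ∈ cspan {T | ∃ a ∈ D.A, ∃ b ∈ D.A, T = D.Δ a * D.R b} :=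
  D.two (nice_clm D.L) (nice_clm D.R) (M := cspanM {T | ∃ a ∈ D.A, ∃ b ∈ D.A, T = D.Δ a * D.R b})
    (isClosed_cspanM _) ((D.podles2 (isClosed_cspanM _)).1
    fun _ _ _ _ => subset_cspan _ ⟨_, D.s_mem _ _, _, D.s_mem _ _, rfl⟩) ha hb

lemma MT_R {x : H2 →L[ℂ] H2} (hx : x ∈ D.MT) {b : H →L[ℂ] H} (hb : b ∈ D.A) :
    x * D.R b ∈ D.MT := by
  refine (nice_pre (D.R b)).mem_cspan D.isClosed_MT ?_ hx
  rintro _ ⟨a, ha, c, hc, rfl⟩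
  have : D.R (c * b) = D.R c * D.R b := amp_mul D.t c b
  change D.L a * D.R c * D.R b ∈ D.MT
  rw [mul_assoc, ← this]
  exact D.MT_mem ha (D.mul_mem hc hb)

lemma ΔMT {a : H →L[ℂ] H} (ha : a ∈ D.A) {x : H2 →L[ℂ] H2} (hx : x ∈ D.MT) :
    D.Δ a * x ∈ D.MT := by
  refine (nice_post (D.Δ a)).mem_cspan D.isClosed_MT ?_ hx
  rintro _ ⟨b, hb, c, hc, rfl⟩
  change D.Δ a * (D.L b * D.R c) ∈ D.MT
  rw [← mul_assoc]
  exact D.MT_R (D.ΔL_mem ha hb) hc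

lemma adj_L (a : H →L[ℂ] H) : adjoint (D.L a) = D.L (adjoint a) := amp_adjoint _ _ _
lemma adj_R (a : H →L[ℂ] H) : adjoint (D.R a) = D.R (adjoint a) := amp_adjoint _ _ _

lemma adj_MT {x : H2 →L[ℂ] H2} (hx : x ∈ D.MT) : adjoint x ∈ D.MT := by
  refine nice_adjoint.mem_cspan D.isClosed_MT ?_ hx
  rintro _ ⟨b, hb, c, hc, rfl⟩
  change adjoint (D.L b ∘L D.R c) ∈ D.MT
  rw [adjoint_comp, adj_L, adj_R]
  have : D.R (adjoint c) ∘L D.L (adjoint b) = D.L (adjoint b) * D.R (adjoint c) :=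
    amp_comm D.t _ _
  rw [this]
  exact D.MT_mem (D.adj_mem hb) (D.adj_mem hc)

lemma MTΔ {a : H →L[ℂ] H} (ha : a ∈ D.A) {x : H2 →L[ℂ] H2} (hx : x ∈ D.MT) :
    x * D.Δ a ∈ D.MT := by
  have h := D.adj_MT (D.ΔMT (D.adj_mem ha) (D.adj_MT hx))
  have h2 : adjoint (D.Δ (adjoint a)) = D.Δ a := by
    rw [Δ, adjoint_comp, adjoint_comp, D.hV, adj_V, adj_L, adjoint_adjoint]; rfl
  change adjoint (D.Δ (adjoint a) ∘L adjoint x) ∈ D.MT at h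
  rwa [adjoint_comp, adjoint_adjoint, h2] at h

end MU
namespace MU
variable {H H2 H3 : Type*}
    [NormedAddCommGroup H] [InnerProductSpace ℂ H] [CompleteSpace H]
    [NormedAddCommGroup H2] [InnerProductSpace ℂ H2] [CompleteSpace H2]
    [NormedAddCommGroup H3] [InnerProductSpace ℂ H3] [CompleteSpace H3]
variable (D : MU H H2 H3)

lemma slicesL_eq : slicesL D.t D.t D.W = {a | ∃ ξ η, a = D.s ξ η} := by
  ext a
  refine exists_congr fun ξ => exists_congr fun η => ⟨fun h => ?_, fun h ζ ζ' => ?_⟩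
  · ext x
    refine ext_inner_left ℂ fun v => ?_
    rw [h, s_apply, inner_bra]
  · rw [h, s_apply, inner_bra]

lemma isTensorOp_LR (a b : H →L[ℂ] H) (T : H2 →L[ℂ] H2) :
    IsTensorOp D.t D.t a b T ↔ T = D.L a * D.R b := by
  constructor
  · intro h
    refine D.t.ext_clm fun x y => D.t.ext_vec fun x' y' => ?_
    rw [h, mul_apply_eq_comp, R_tmul, L_tmul, D.t.inner_tmul]
  · rintro rfl ζ ξ ζ' η
    rw [mul_apply_eq_comp, R_tmul, L_tmul, D.t.inner_tmul]

lemma isTensorOp_L (a : H →L[ℂ] H) (T : H2 →L[ℂ] H2) :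
    IsTensorOp D.t D.t a 1 T ↔ T = D.L a := by
  have : D.R 1 = 1 := amp_one D.t
  rw [isTensorOp_LR, this, mul_one]

lemma isTensorOp_R (a : H →L[ℂ] H) (T : H2 →L[ℂ] H2) :
    IsTensorOp D.t D.t 1 a T ↔ T = D.R a := by
  have : D.L 1 = 1 := amp_one D.t.swap
  rw [isTensorOp_LR, this, one_mul]

end MU

section final
variable {H H2 H3 : Type*}
    [NormedAddCommGroup H] [InnerProductSpace ℂ H] [CompleteSpace H]
    [NormedAddCommGroup H2] [InnerProductSpace ℂ H2] [CompleteSpace H2]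
    [NormedAddCommGroup H3] [InnerProductSpace ℂ H3] [CompleteSpace H3]

lemma triple_ext (t3 : TensorTriple H H H H3) {S T : H3 →L[ℂ] H3}
    (h : ∀ a b c a' b' c', ⟪t3.tmul a b c, S (t3.tmul a' b' c')⟫_ℂ
      = ⟪t3.tmul a b c, T (t3.tmul a' b' c')⟫_ℂ) : S = T := by
  refine ContinuousLinearMap.ext_on t3.dense_span ?_
  rintro _ ⟨a', b', c', rfl⟩
  refine t3.dense_span.eq_of_inner_right ℂ fun v hv => ?_
  induction hv using Submodule.span_induction with
  | mem v hv => obtain ⟨a, b, c, rfl⟩ := hv; exact h a b c a' b' c'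
  | zero => simp
  | add u v _ _ hu hv => simp [inner_add_left, hu, hv]
  | smul c u _ hu => simp [inner_smul_left, hu]

/-- An operator with the right coefficients is an amplification. -/
lemma amp_eq (t2 : TensorPair H H H2) (q : TensorPair H H2 H3) (W : H2 →L[ℂ] H2)
    (a a' b b' c c' : H) :
    ⟪q.tmul a (t2.tmul b c), amp q q W (q.tmul a' (t2.tmul b' c'))⟫_ℂ
      = ⟪t2.tmul b c, W (t2.tmul b' c')⟫_ℂ * ⟪a, a'⟫_ℂ := by
  rw [amp_tmul, q.inner_tmul, mul_comm]

lemma exists_MU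
    (t2 : TensorPair H H H2) (t3 : TensorTriple H H H H3)
    (W : H2 →L[ℂ] H2) (hWu : star W * W = 1 ∧ W * star W = 1)
    (W12 W23 W13 : H3 →L[ℂ] H3)
    (hW12 : IsLeg12 t2 t3 W W12) (hW23 : IsLeg23 t2 t3 W W23)
    (hW13 : IsLeg13 t2 t3 W W13)
    (hpent : W23 * W12 = W12 * W13 * W23)
    (Sg : H2 →L[ℂ] H2) (hSg : ∀ a b : H, Sg (t2.tmul a b) = t2.tmul b a)
    (hreg : hatA t2 (Sg * W) = {T : H →L[ℂ] H | IsCompactOperator T}) :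
    ∃ D : MU H H2 H3, D.t = t2 ∧ D.W = W := by
  let q1 : TensorPair H H2 H3 := assoc t2 t3.tmul
    (fun g g' e e' f f' => by rw [t3.inner_tmul, mul_assoc]) t3.dense_span
  have e1 : ∀ a b c, q1.tmul a (t2.tmul b c) = t3.tmul a b c := fun a b c => assoc_tmul _ _ _ _ _ _ _
  let q2 : TensorPair H H2 H3 := assoc t2 t3.tmul.flip
    (fun g g' e e' f f' => by simp only [LinearMap.flip_apply]; rw [t3.inner_tmul]; ring) (by
      refine t3.dense_span.mono (Submodule.span_mono ?_)
      rintro _ ⟨a, b, c, rfl⟩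
      exact ⟨b, a, c, rfl⟩)
  have e2 : ∀ a b c, q2.tmul b (t2.tmul a c) = t3.tmul a b c := fun a b c => assoc_tmul _ _ _ _ _ _ _
  let q3 : TensorPair H H2 H3 := assoc t2
    (LinearMap.flip ((LinearMap.lflip (R₀ := ℂ)).toLinearMap ∘ₗ t3.tmul))
    (fun g g' e e' f f' => by
      change ⟪t3.tmul e f g, t3.tmul e' f' g'⟫_ℂ = _
      rw [t3.inner_tmul]; ring) (by
      refine t3.dense_span.mono (Submodule.span_mono ?_)
      rintro _ ⟨a, b, c, rfl⟩
      exact ⟨c, a, b, rfl⟩)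
  have e3 : ∀ a b c, q3.tmul c (t2.tmul a b) = t3.tmul a b c := fun a b c => assoc_tmul _ _ _ _ _ _ _
  have h23 : W23 = amp q1 q1 W := triple_ext t3 fun a b c a' b' c' => by
    rw [hW23, ← e1, ← e1, amp_eq]
  have h13 : W13 = amp q2 q2 W := triple_ext t3 fun a b c a' b' c' => by
    rw [hW13, ← e2, ← e2, amp_eq]
  have h12 : W12 = amp q3 q3 W := triple_ext t3 fun a b c a' b' c' => by
    rw [hW12, ← e3, ← e3, amp_eq]
  refine ⟨{ t := t2, q1 := q1, q2 := q2, q3 := q3, W := W, V := star W, hV := rfl,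
            h12 := fun a b c => by rw [e1, e2], h32 := fun a b c => by rw [e3, e2],
            hWV := hWu.2, hVW := hWu.1, pent := by rw [← h12, ← h13, ← h23]; exact hpent,
            reg := ?_ }, rfl, rfl⟩
  have hSS : ∀ x y, ⟪x, Sg y⟫_ℂ = ⟪Sg x, y⟫_ℂ := fun x y => by
    have : adjoint Sg = Sg := by
      refine t2.ext_clm fun a b => t2.ext_vec fun c d => ?_
      rw [adjoint_inner_right, hSg, hSg, t2.inner_tmul, t2.inner_tmul, mul_comm]
    rw [← adjoint_inner_left, this]
  have hs : slicesR t2 t2 (Sg * W)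
      = {T : H →L[ℂ] H | ∃ ξ η, T = t2.bra ξ ∘L W ∘L t2.swap.ket η} := by
    ext a
    have key : ∀ ξ η ζ ζ', ⟪t2.tmul ζ ξ, (Sg * W) (t2.tmul ζ' η)⟫_ℂ
        = ⟪ζ, (t2.bra ξ ∘L W ∘L t2.swap.ket η) ζ'⟫_ℂ := fun ξ η ζ ζ' => by
      rw [mul_apply_eq_comp, hSS, hSg]
      simp only [ContinuousLinearMap.comp_apply, inner_bra, ket_apply, swap_tmul]
    refine exists_congr fun ξ => exists_congr fun η => ⟨fun h => ?_, fun h ζ ζ' => ?_⟩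
    · ext x
      exact ext_inner_left ℂ fun v => by rw [h, key]
    · rw [key, h]
  rw [← hs]
  change hatA t2 (Sg * W) = _
  rw [hreg]
  refine Set.Subset.antisymm (fun T hT => compact_mem hT) ?_
  rw [← hreg]
  refine cspan_subset (isClosed_cspanM _) ?_
  rintro _ ⟨p, q, rfl⟩
  change _ ∈ hatA t2 (Sg * W)
  rw [hreg]
  exact rankOne_compact p q

end final

/-- For a bi-regular multiplicative unitary `W` on `H` and
`Δ(a) := W(a ⊗ 1)W*`, the Podleś conditions
`[Δ(A(W))·(A(W) ⊗ 1)] = A(W) ⊗min A(W) = [Δ(A(W))·(1 ⊗ A(W))]` hold; in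
particular `Δ` maps `A(W)` into the multipliers of `A(W) ⊗min A(W)`. -/
theorem statement19
    {H H2 H3 : Type*}
    [NormedAddCommGroup H] [InnerProductSpace ℂ H] [CompleteSpace H]
    [NormedAddCommGroup H2] [InnerProductSpace ℂ H2] [CompleteSpace H2]
    [NormedAddCommGroup H3] [InnerProductSpace ℂ H3] [CompleteSpace H3]
    -- realizations of the tensor products H ⊗ H and H ⊗ H ⊗ H
    (t2 : TensorPair H H H2) (t3 : TensorTriple H H H H3)
    -- W is a unitary on H ⊗ H
    (W : H2 →L[ℂ] H2) (hWu : star W * W = 1 ∧ W * star W = 1)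
    -- the legs W₁₂, W₂₃, W₁₃ of W on H ⊗ H ⊗ H
    (W12 W23 W13 : H3 →L[ℂ] H3)
    (hW12 : IsLeg12 t2 t3 W W12) (hW23 : IsLeg23 t2 t3 W W23)
    (hW13 : IsLeg13 t2 t3 W W13)
    -- the pentagon equation W₂₃W₁₂ = W₁₂W₁₃W₂₃
    (hpent : W23 * W12 = W12 * W13 * W23)
    -- the tensor flip Σ on H ⊗ H
    (Sg : H2 →L[ℂ] H2) (hSg : ∀ a b : H, Sg (t2.tmul a b) = t2.tmul b a)
    -- bi-regularity: C(W) = K(H) and [(ω_{ξ,η} ⊗ id)(ΣW)] = K(H)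
    (hreg : hatA t2 (Sg * W) = {T : H →L[ℂ] H | IsCompactOperator T})
    (hreg' : legA t2 (Sg * W) = {T : H →L[ℂ] H | IsCompactOperator T}) :
    cspan {y : H2 →L[ℂ] H2 | ∃ a ∈ legA t2 W, ∃ b ∈ legA t2 W,
        ∃ Ta Tb : H2 →L[ℂ] H2, IsTensorOp t2 t2 a 1 Ta ∧ IsTensorOp t2 t2 b 1 Tb ∧
          y = (W * Ta * star W) * Tb}
      = minTensor t2 (legA t2 W) (legA t2 W) ∧
    cspan {y : H2 →L[ℂ] H2 | ∃ a ∈ legA t2 W, ∃ b ∈ legA t2 W,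
        ∃ Ta Tb : H2 →L[ℂ] H2, IsTensorOp t2 t2 a 1 Ta ∧ IsTensorOp t2 t2 1 b Tb ∧
          y = (W * Ta * star W) * Tb}
      = minTensor t2 (legA t2 W) (legA t2 W) ∧
    (∀ a ∈ legA t2 W, ∀ Ta : H2 →L[ℂ] H2, IsTensorOp t2 t2 a 1 Ta →
      ∀ x ∈ minTensor t2 (legA t2 W) (legA t2 W),
        (W * Ta * star W) * x ∈ minTensor t2 (legA t2 W) (legA t2 W) ∧
        x * (W * Ta * star W) ∈ minTensor t2 (legA t2 W) (legA t2 W)) := by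
  obtain ⟨D, hDt, hDW⟩ := exists_MU t2 t3 W hWu W12 W23 W13 hW12 hW23 hW13 hpent Sg hSg hreg
  have hV : star W = D.V := by rw [← hDW, ← D.hV]; rfl
  have hA : ∀ a, a ∈ legA t2 W ↔ a ∈ D.A := fun a => by
    rw [legA, MU.A, mem_cspanM, ← hDt, ← hDW, D.slicesL_eq]
  have hL : ∀ a T, IsTensorOp t2 t2 a 1 T ↔ T = D.L a := by rw [← hDt]; exact D.isTensorOp_L
  have hR : ∀ a T, IsTensorOp t2 t2 1 a T ↔ T = D.R a := by rw [← hDt]; exact D.isTensorOp_R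
  have hLR : ∀ a b T, IsTensorOp t2 t2 a b T ↔ T = D.L a * D.R b := by
    rw [← hDt]; exact D.isTensorOp_LR
  have hΔ : ∀ a, W * D.L a * star W = D.Δ a := fun a => by rw [hV, ← hDW]; rfl
  have hMT : minTensor t2 (legA t2 W) (legA t2 W) = (D.MT : Set (H2 →L[ℂ] H2)) := by
    simp only [minTensor, hA, hLR]; rfl
  rw [hMT]
  simp only [hA, hL, hR]
  refine ⟨?_, ?_, ?_⟩
  · refine cspan_eq ?_ ?_
    · rintro _ ⟨a, ha, b, hb, _, _, rfl, rfl, rfl⟩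
      rw [hΔ]; exact D.ΔL_mem ha hb
    · rintro _ ⟨a, ha, b, hb, rfl⟩
      refine cspan_subset (isClosed_cspanM _) ?_ _ (D.LR_mem1 ha hb)
      rintro _ ⟨a, ha, b, hb, rfl⟩
      exact subset_cspan _ ⟨a, ha, b, hb, _, _, rfl, rfl, by rw [hΔ]⟩
  · refine cspan_eq ?_ ?_
    · rintro _ ⟨a, ha, b, hb, _, _, rfl, rfl, rfl⟩
      rw [hΔ]; exact D.ΔR_mem ha hb
    · rintro _ ⟨a, ha, b, hb, rfl⟩
      refine cspan_subset (isClosed_cspanM _) ?_ _ (D.LR_mem2 ha hb)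
      rintro _ ⟨a, ha, b, hb, rfl⟩
      exact subset_cspan _ ⟨a, ha, b, hb, _, _, rfl, rfl, by rw [hΔ]⟩
  · rintro a ha _ rfl x hx
    rw [hΔ]
    exact ⟨D.ΔMT ha hx, D.MTΔ ha hx⟩

end
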